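/- Let B be the 8 × 8 matrix with rows (−3,1,0,1,1,0,0,0), (1,−3,1,0,0,1,0,0), (0,1,−3,1,0,0,1,0), (1,0,1,−3,0,0,0,1), (1,0,0,0,−3,1,0,1), (0,1,0,0,1,−3,1,0), (0,0,1,0,0,1,−3,1), (0,0,0,1,1,0,1,−3). Let c₁, c₂ ∈ ℝ, α > 0, let l ≥ 1 be an integer, set M := c₁·Id₈ + c₂·B + e^{−(lα)²/2}·Id₈, and let A_l be the 16 × 16 complex matrix given in 8 × 8 blocks by A_l = [[Id, −(1/(i·l))·Id], [−(1/(i·l))·M, Id]]. Then λ ∈ ℂ is an eigenvalue of A_l if and only if l²·(1 − λ)² = −c₁ + 2k·c₂ − e^{−(lα)²/2} for some k ∈ {0, 1, 2, 3}. -/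

import Mathlib

open Complex Matrix

/-- The coupling matrix of the cube-symmetric network of 8 oscillators (over `ℂ`). -/
def cubeB : Matrix (Fin 8) (Fin 8) ℂ :=
  !![-3,  1,  0,  1,  1,  0,  0,  0;
      1, -3,  1,  0,  0,  1,  0,  0;
      0,  1, -3,  1,  0,  0,  1,  0;
      1,  0,  1, -3,  0,  0,  0,  1;
      1,  0,  0,  0, -3,  1,  0,  1;
      0,  1,  0,  0,  1, -3,  1,  0;
      0,  0,  1,  0,  0,  1, -3,  1;
      0,  0,  0,  1,  1,  0,  1, -3]

/-- `M = c₁·Id + c₂·B + e^{-(lα)²/2}·Id` for the IDE network with Gaussian kernel. -/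
noncomputable def ideM (c₁ c₂ α : ℝ) (l : ℕ) : Matrix (Fin 8) (Fin 8) ℂ :=
  (c₁ : ℂ) • (1 : Matrix (Fin 8) (Fin 8) ℂ) + (c₂ : ℂ) • cubeB +
    ((Real.exp (-((l : ℝ) * α) ^ 2 / 2) : ℝ) : ℂ) • (1 : Matrix (Fin 8) (Fin 8) ℂ)

/-- The linearization `A_l = [[Id, -(1/(il))·Id], [-(1/(il))·M, Id]]` of the IDE network on
the `l`-th Fourier mode. -/
noncomputable def ideAl (c₁ c₂ α : ℝ) (l : ℕ) :
    Matrix (Fin 8 ⊕ Fin 8) (Fin 8 ⊕ Fin 8) ℂ :=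
  Matrix.fromBlocks 1 (-(1 / (Complex.I * (l : ℂ))) • (1 : Matrix (Fin 8) (Fin 8) ℂ))
    (-(1 / (Complex.I * (l : ℂ))) • ideM c₁ c₂ α l) 1

/-- The character table of `(ℤ/2)³`, with rows ordered along the vertices of the cube as in
`cubeB`; its columns are eigenvectors of `cubeB`. -/
def cubeCharacters : Matrix (Fin 8) (Fin 8) ℂ :=
  !![1,  1,  1,  1,  1,  1,  1,  1;
     1, -1,  1,  1, -1, -1,  1, -1;
     1, -1, -1,  1,  1, -1, -1,  1;
     1,  1, -1,  1, -1,  1, -1, -1;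
     1,  1,  1, -1,  1, -1, -1, -1;
     1, -1,  1, -1, -1,  1, -1,  1;
     1, -1, -1, -1,  1,  1,  1, -1;
     1,  1, -1, -1, -1, -1,  1,  1]

/-- The eigenvalues of `cubeB`, in the order of the columns of `cubeCharacters`. -/
def cubeEigenvalues : Fin 8 → ℂ := ![0, -2, -2, -2, -4, -4, -4, -6]

theorem cubeCharacters_transpose_mul_self :
    cubeCharactersᵀ * cubeCharacters = (8 : ℂ) • 1 := by
  ext i j
  fin_cases i <;> fin_cases j <;>
    simp [cubeCharacters, Matrix.mul_apply, Fin.sum_univ_succ] <;> norm_num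

theorem cubeB_mul_cubeCharacters :
    cubeB * cubeCharacters = cubeCharacters * diagonal cubeEigenvalues := by
  ext i j
  rw [mul_diagonal]
  fin_cases i <;> fin_cases j <;>
    simp [cubeB, cubeCharacters, cubeEigenvalues, Matrix.mul_apply, Fin.sum_univ_succ] <;>
    norm_num

theorem det_cubeCharacters_ne_zero : cubeCharacters.det ≠ 0 := by
  intro h
  have := congrArg det cubeCharacters_transpose_mul_self
  norm_num [h] at this

theorem det_smul_one_add_smul_cubeB (a b : ℂ) :
    (a • (1 : Matrix (Fin 8) (Fin 8) ℂ) + b • cubeB).det = ∏ i, (a + b * cubeEigenvalues i) := by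
  have h : (a • (1 : Matrix (Fin 8) (Fin 8) ℂ) + b • cubeB) * cubeCharacters =
      cubeCharacters * diagonal fun i => a + b * cubeEigenvalues i := by
    have hd : (diagonal fun i => a + b * cubeEigenvalues i) =
        a • (1 : Matrix (Fin 8) (Fin 8) ℂ) + b • diagonal cubeEigenvalues := by
      ext i j
      by_cases hij : i = j <;> simp [hij]
    rw [hd, add_mul, mul_add, smul_mul_assoc, smul_mul_assoc, cubeB_mul_cubeCharacters]
    simp
  apply mul_right_cancel₀ det_cubeCharacters_ne_zero
  rw [← det_mul, h, det_mul, det_diagonal, mul_comm]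

theorem det_smul_one_add_smul_cubeB_eq_zero_iff (a b : ℂ) :
    (a • (1 : Matrix (Fin 8) (Fin 8) ℂ) + b • cubeB).det = 0 ↔
      ∃ k : Fin 4, a = 2 * ((k : ℕ) : ℂ) * b := by
  rw [det_smul_one_add_smul_cubeB]
  rw [Finset.prod_eq_zero_iff]
  constructor
  · rintro ⟨i, -, hi⟩
    refine ⟨![0, 1, 1, 1, 2, 2, 2, 3] i, ?_⟩
    fin_cases i <;> simp [cubeEigenvalues] at hi ⊢ <;> linear_combination hi
  · rintro ⟨k, hk⟩
    refine ⟨![0, 1, 4, 7] k, Finset.mem_univ _, ?_⟩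
    fin_cases k <;> simp [cubeEigenvalues] at hk ⊢ <;> linear_combination hk

/-- The Schur complement formula for a block matrix with equal scalar diagonal blocks, without an
invertibility hypothesis on the scalar. -/
theorem det_fromBlocks_smul_one {R n : Type*} [CommRing R] [Fintype n] [DecidableEq n]
    (t : R) (B C : Matrix n n R) :
    (fromBlocks (t • (1 : Matrix n n R)) B C (t • 1)).det = (t ^ 2 • 1 - C * B).det := by
  have cancel {S : Type _} [CommRing S] (u : S) (B' C' : Matrix n n S) :
      (fromBlocks (u • (1 : Matrix n n S)) B' C' (u • 1)).det * u ^ Fintype.card n =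
        (u ^ 2 • 1 - C' * B').det * u ^ Fintype.card n := by
    have h : fromBlocks (u • (1 : Matrix n n S)) B' C' (u • 1) * fromBlocks 1 (-B') 0 (u • 1) =
        fromBlocks (u • 1) 0 C' (u ^ 2 • 1 - C' * B') := by
      rw [fromBlocks_multiply]
      congr 1 <;> simp [smul_smul, pow_two, sub_eq_neg_add]
    have hdet := congrArg det h
    rw [det_mul, det_fromBlocks_zero₂₁, det_fromBlocks_zero₁₂] at hdet
    simpa [det_smul, mul_comm] using hdet
  have hX := (Polynomial.monic_X_pow (R := R) (Fintype.card n)).isRegular.right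
    (cancel Polynomial.X (B.map Polynomial.C) (C.map Polynomial.C))
  have ht := congrArg (Polynomial.evalRingHom t) hX
  rw [RingHom.map_det, RingHom.map_det] at ht
  convert ht using 2
  · ext (i | i) (j | j) <;> simp [Matrix.one_apply, apply_ite (Polynomial.eval t)]
  · ext i j
    simp [Matrix.one_apply, Matrix.mul_apply, Polynomial.eval_finsetSum,
      apply_ite (Polynomial.eval t)]

/-- `λ ∈ ℂ` is an eigenvalue of the `l`-th Fourier-mode linearization `A_l` of the
cube-symmetric IDE network iff `l²(1-λ)² = -c₁ + 2k c₂ - e^{-(lα)²/2}` for some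
`k ∈ {0, 1, 2, 3}`. -/
theorem ideAl_eigenvalues (c₁ c₂ : ℝ) (α : ℝ) (hα : 0 < α) (l : ℕ) (hl : 1 ≤ l) (lam : ℂ) :
    (ideAl c₁ c₂ α l - lam • (1 : Matrix (Fin 8 ⊕ Fin 8) (Fin 8 ⊕ Fin 8) ℂ)).det = 0 ↔
    ∃ k : Fin 4, (l : ℂ) ^ 2 * (1 - lam) ^ 2
        = -(c₁ : ℂ) + 2 * ((k : ℕ) : ℂ) * (c₂ : ℂ)
          - ((Real.exp (-((l : ℝ) * α) ^ 2 / 2) : ℝ) : ℂ) := by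
  have hl0 : (l : ℂ) ≠ 0 := by exact_mod_cast (by lia : l ≠ 0)
  set e : ℂ := ((Real.exp (-((l : ℝ) * α) ^ 2 / 2) : ℝ) : ℂ) with he
  have hblocks : ideAl c₁ c₂ α l - lam • (1 : Matrix (Fin 8 ⊕ Fin 8) (Fin 8 ⊕ Fin 8) ℂ) =
      fromBlocks ((1 - lam) • (1 : Matrix (Fin 8) (Fin 8) ℂ))
        (-(1 / (I * (l : ℂ))) • (1 : Matrix (Fin 8) (Fin 8) ℂ))
        (-(1 / (I * (l : ℂ))) • ideM c₁ c₂ α l) ((1 - lam) • 1) := by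
    rw [ideAl, ← fromBlocks_one, fromBlocks_smul, sub_eq_add_neg, fromBlocks_neg, fromBlocks_add]
    simp [add_smul, sub_eq_add_neg]
  have hsq : -(1 / (I * (l : ℂ))) * -(1 / (I * (l : ℂ))) = -(1 / (l : ℂ) ^ 2) := by
    field_simp
    simp
  have hschur : (1 - lam) ^ 2 • (1 : Matrix (Fin 8) (Fin 8) ℂ) -
      -(1 / (I * (l : ℂ))) • ideM c₁ c₂ α l * -(1 / (I * (l : ℂ))) • 1 =
      (1 / (l : ℂ) ^ 2) • (((l : ℂ) ^ 2 * (1 - lam) ^ 2 + c₁ + e) • 1 + (c₂ : ℂ) • cubeB) := by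
    rw [smul_mul_smul_comm, mul_one, hsq, ideM, ← he]
    match_scalars <;> field_simp
    ring
  rw [hblocks, det_fromBlocks_smul_one, hschur, det_smul, mul_eq_zero,
    or_iff_right (by simp [hl0]), det_smul_one_add_smul_cubeB_eq_zero_iff]
  refine exists_congr fun k => ?_
  constructor <;> intro h <;> linear_combination h
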